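/- Let Γ be a connected Artin graph with at least 3 vertices containing an edge {x,y} labeled p > 2, and suppose Γ contains no induced labeled subgraph isomorphic to any of: P_4 or C_4 with all edges labeled 2, S_p with p > 2, S_{p,q} with p, q > 2, P_3^{m,n} with m + n > 4, or a triangle Δ_{l,m,n} with at most one edge labeled 2. Then there exists a vertex l of Γ, which is a common neighbor of x and y, such that l is central in Γ: l is adjacent to every other vertex of Γ and all edges incident to l are labeled 2. Consequently A(Γ) is isomorphic to ℤ × A(Γ∖{l}), where Γ∖{l} is the induced subgraph on V(Γ)∖{l}. -/

import Mathlib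

/-- The alternating product `u v u v …` of length `m`. -/
def altProd {G : Type*} [Monoid G] (u v : G) (m : ℕ) : G :=
  ((List.range m).map (fun i => if i % 2 = 0 then u else v)).prod

/-- Relations of the Artin group of an Artin graph `(G, ℓ)`:
`(u,v)_{ℓ u v} = (v,u)_{ℓ u v}` for each edge `{u,v}`. -/
def artinRels {V : Type*} (G : SimpleGraph V) (ℓ : V → V → ℕ) : Set (FreeGroup V) :=
  {r | ∃ u v : V, G.Adj u v ∧
    r = altProd (FreeGroup.of u) (FreeGroup.of v) (ℓ u v) *
        (altProd (FreeGroup.of v) (FreeGroup.of u) (ℓ u v))⁻¹}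

/-- The Artin group of an Artin graph `(G, ℓ)`. -/
abbrev ArtinGroup {V : Type*} (G : SimpleGraph V) (ℓ : V → V → ℕ) :=
  PresentedGroup (artinRels G ℓ)

/-- The Artin graph `(Γ, ℓ)` contains the Artin graph `(H, ℓ′)` as an induced labeled
subgraph: there is an injection of vertices preserving and reflecting adjacency and
preserving the edge labels. -/
def HasInducedLabeled {V W : Type*} (Γ : SimpleGraph V) (ℓ : V → V → ℕ)
    (H : SimpleGraph W) (ℓ' : W → W → ℕ) : Prop :=
  ∃ φ : W → V, Function.Injective φ ∧
    (∀ i j, Γ.Adj (φ i) (φ j) ↔ H.Adj i j) ∧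
    (∀ i j, H.Adj i j → ℓ (φ i) (φ j) = ℓ' i j)

/-- The graph underlying the chordal Artin squares `S_p` and `S_{p,q}` (without the diagonal
`{a,c}` for `S_p`): vertices `a = 0, b = 1, c = 2, d = 3`. The graph of `S_p` is the complete
graph on four vertices minus the diagonal `{a, c} = {0, 2}`. -/
def SpGraph : SimpleGraph (Fin 4) :=
  (⊤ : SimpleGraph (Fin 4)).deleteEdges {s((0 : Fin 4), (2 : Fin 4))}

/-- Labels for `S_p`: the diagonal `{b, d} = {1, 3}` is labeled `p`, all square edges are
labeled `2`. -/
def SpLabel (p : ℕ) : Fin 4 → Fin 4 → ℕ := fun i j =>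
  if (i = 1 ∧ j = 3) ∨ (i = 3 ∧ j = 1) then p else 2

/-- Labels for `S_{p,q}` (on the complete graph on four vertices): the diagonal `{b, d} = {1, 3}`
is labeled `p`, the diagonal `{a, c} = {0, 2}` is labeled `q`, and the square edges are
labeled `2`. -/
def SpqLabel (p q : ℕ) : Fin 4 → Fin 4 → ℕ := fun i j =>
  if (i = 1 ∧ j = 3) ∨ (i = 3 ∧ j = 1) then p
  else if (i = 0 ∧ j = 2) ∨ (i = 2 ∧ j = 0) then q
  else 2

/-- Labels for the path `P₃^{m,n}` on vertices `a = 0, b = 1, c = 2`: the edge `{a, b}` is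
labeled `m` and the edge `{b, c}` is labeled `n`. -/
def P3Label (m n : ℕ) : Fin 3 → Fin 3 → ℕ := fun i j =>
  if (i = 0 ∧ j = 1) ∨ (i = 1 ∧ j = 0) then m else n

/-- Labels for the triangle `Δ_{l,m,n}` on vertices `a = 0, b = 1, c = 2`: the edge `{a, b}`
is labeled `l`, the edge `{b, c}` is labeled `m`, and the edge `{a, c}` is labeled `n`. -/
def triLabel (l m n : ℕ) : Fin 3 → Fin 3 → ℕ := fun i j =>
  if (i = 0 ∧ j = 1) ∨ (i = 1 ∧ j = 0) then l
  else if (i = 1 ∧ j = 2) ∨ (i = 2 ∧ j = 1) then m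
  else n

/-- The Artin graph `(Γ, ℓ)` contains one of the forbidden induced labeled subgraphs other
than the triangles: `P₄` or `C₄` with all edges labeled `2`, a chordal Artin square `S_p` with
`p > 2`, a chordal Artin square `S_{p,q}` with `p, q > 2`, or a path `P₃^{m,n}` with
`m + n > 4`. -/
def HasForbiddenNonTriangle {V : Type*} (Γ : SimpleGraph V) (ℓ : V → V → ℕ) : Prop :=
  HasInducedLabeled Γ ℓ (SimpleGraph.pathGraph 4) (fun _ _ => 2) ∨
  HasInducedLabeled Γ ℓ (SimpleGraph.cycleGraph 4) (fun _ _ => 2) ∨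
  (∃ p, 2 < p ∧ HasInducedLabeled Γ ℓ SpGraph (SpLabel p)) ∨
  (∃ p q, 2 < p ∧ 2 < q ∧
    HasInducedLabeled Γ ℓ (⊤ : SimpleGraph (Fin 4)) (SpqLabel p q)) ∨
  (∃ m n, 2 ≤ m ∧ 2 ≤ n ∧ 4 < m + n ∧
    HasInducedLabeled Γ ℓ (SimpleGraph.pathGraph 3) (P3Label m n))

/-- The Artin graph `(Γ, ℓ)` contains a forbidden triangle: an induced triangle `Δ_{l,m,n}`
with at most one edge labeled `2`. -/
def HasForbiddenTriangle {V : Type*} (Γ : SimpleGraph V) (ℓ : V → V → ℕ) : Prop :=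
  ∃ l m n, 2 ≤ l ∧ 2 ≤ m ∧ 2 ≤ n ∧
    ((if l = 2 then 1 else 0) + (if m = 2 then 1 else 0) + (if n = 2 then 1 else 0) ≤ 1) ∧
    HasInducedLabeled Γ ℓ (⊤ : SimpleGraph (Fin 3)) (triLabel l m n)

theorem altProd_map {G H : Type*} [Monoid G] [Monoid H] (φ : G →* H) (u v : G) (m : ℕ) :
    φ (altProd u v m) = altProd (φ u) (φ v) m := by
  unfold altProd
  rw [map_list_prod, List.map_map]
  congr 1
  apply List.map_congr_left
  intro i _
  simp only [Function.comp]
  split_ifs <;> rfl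

theorem altProd_two {G : Type*} [Monoid G] (u v : G) : altProd u v 2 = u * v := by
  simp [altProd, List.range_succ]

theorem artin_rel {V : Type*} (G : SimpleGraph V) (ℓ : V → V → ℕ) (u v : V) (h : G.Adj u v) :
    altProd (PresentedGroup.of u : ArtinGroup G ℓ) (PresentedGroup.of v) (ℓ u v) =
    altProd (PresentedGroup.of v) (PresentedGroup.of u) (ℓ u v) := by
  have h1 : PresentedGroup.mk (artinRels G ℓ)
      (altProd (FreeGroup.of u) (FreeGroup.of v) (ℓ u v) *
        (altProd (FreeGroup.of v) (FreeGroup.of u) (ℓ u v))⁻¹) = 1 :=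
    PresentedGroup.one_of_mem ⟨u, v, h, rfl⟩
  rw [map_mul, map_inv, mul_inv_eq_one, altProd_map, altProd_map] at h1
  exact h1

theorem artin_lift_rels {V : Type*} {G : SimpleGraph V} {ℓ : V → V → ℕ} {K : Type*} [Group K]
    (f : V → K) (h : ∀ u v, G.Adj u v → altProd (f u) (f v) (ℓ u v) = altProd (f v) (f u) (ℓ u v)) :
    ∀ r ∈ artinRels G ℓ, FreeGroup.lift f r = 1 := by
  rintro r ⟨u, v, huv, rfl⟩
  rw [map_mul, map_inv, mul_inv_eq_one, altProd_map, altProd_map]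
  simpa using h u v huv

theorem central_iso {V : Type*} (Γ : SimpleGraph V) (ℓ : V → V → ℕ)
    (hsymm : ∀ u v, ℓ u v = ℓ v u) (l : V) (hl : ∀ v, v ≠ l → Γ.Adj l v ∧ ℓ l v = 2) :
    Nonempty (ArtinGroup Γ ℓ ≃*
        Multiplicative ℤ ×
          ArtinGroup (Γ.induce {v : V | v ≠ l}) (fun u v => ℓ u v)) := by
  classical
  let Γ' := Γ.induce {v : V | v ≠ l}
  let ℓ' : {v : V | v ≠ l} → {v : V | v ≠ l} → ℕ := fun u v => ℓ u v
  let f : V → Multiplicative ℤ × ArtinGroup Γ' ℓ' := fun v =>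
    if h : v = l then (Multiplicative.ofAdd 1, 1) else (1, PresentedGroup.of ⟨v, h⟩)
  have fl : f l = (Multiplicative.ofAdd 1, 1) := by simp [f]
  have fn : ∀ v (h : v ≠ l), f v = (1, PresentedGroup.of ⟨v, h⟩) := fun v h => by simp [f, h]
  have hf : ∀ u v, Γ.Adj u v → altProd (f u) (f v) (ℓ u v) = altProd (f v) (f u) (ℓ u v) := by
    intro u v huv
    by_cases hu : u = l
    · subst hu
      have hv : v ≠ u := huv.ne'
      rw [(hl v hv).2, altProd_two, altProd_two, fl, fn v hv]
      simp
    by_cases hv : v = l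
    · subst hv
      rw [hsymm, (hl u hu).2, altProd_two, altProd_two, fl, fn u hu]
      simp
    · rw [fn u hu, fn v hv]
      have h2 := artin_rel Γ' ℓ' ⟨u, hu⟩ ⟨v, hv⟩ huv
      have h3 := congrArg (MonoidHom.inr (Multiplicative ℤ) (ArtinGroup Γ' ℓ')) h2
      rw [altProd_map, altProd_map] at h3
      exact h3
  let F : ArtinGroup Γ ℓ →* Multiplicative ℤ × ArtinGroup Γ' ℓ' :=
    PresentedGroup.toGroup (artin_lift_rels f hf)
  have hF : ∀ v, F (PresentedGroup.of v) = f v := fun v => PresentedGroup.toGroup.of _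
  let g : {v : V | v ≠ l} → ArtinGroup Γ ℓ := fun v => PresentedGroup.of v.1
  have hg : ∀ u v, Γ'.Adj u v → altProd (g u) (g v) (ℓ' u v) = altProd (g v) (g u) (ℓ' u v) :=
    fun u v huv => artin_rel Γ ℓ u.1 v.1 huv
  let G2 : ArtinGroup Γ' ℓ' →* ArtinGroup Γ ℓ := PresentedGroup.toGroup (artin_lift_rels g hg)
  have hG2 : ∀ v, G2 (PresentedGroup.of v) = g v := fun v => PresentedGroup.toGroup.of _
  let L : ArtinGroup Γ ℓ := PresentedGroup.of l
  have hcomm0 : ∀ a, Commute L (G2 a) := by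
    have : (⊤ : Subgroup (ArtinGroup Γ' ℓ')) ≤ (Subgroup.centralizer {L}).comap G2 := by
      rw [← PresentedGroup.closure_range_of, Subgroup.closure_le]
      rintro _ ⟨v, rfl⟩
      simp only [Subgroup.coe_comap, Set.mem_preimage, SetLike.mem_coe,
        Subgroup.mem_centralizer_singleton_iff, hG2]
      have := artin_rel Γ ℓ l v.1 (hl v.1 v.2).1
      rw [(hl v.1 v.2).2, altProd_two, altProd_two] at this
      first | exact this | exact this.symm
    intro a
    have h4 := this (Subgroup.mem_top a)
    rw [Subgroup.mem_comap, Subgroup.mem_centralizer_singleton_iff] at h4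
    first | exact h4 | exact h4.symm
  let Z : Multiplicative ℤ →* ArtinGroup Γ ℓ := zpowersHom _ L
  have hZ : Z (Multiplicative.ofAdd 1) = L := by simp [Z]
  let B : Multiplicative ℤ × ArtinGroup Γ' ℓ' →* ArtinGroup Γ ℓ :=
    MonoidHom.noncommCoprod Z G2 (fun m a => by
      have := (hcomm0 a).zpow_left m.toAdd
      simpa [Z] using this)
  refine ⟨MonoidHom.toMulEquiv F B ?_ ?_⟩
  · apply PresentedGroup.ext
    intro v
    simp only [MonoidHom.comp_apply, MonoidHom.id_apply, hF]
    by_cases hv : v = l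
    · subst hv
      rw [fl]
      simp [B, hZ, L]
    · rw [fn v hv]
      simp [B, hG2, g]
  · have e1 : ((F.comp B).comp (MonoidHom.inl _ _)) = MonoidHom.inl _ _ := by
      apply MonoidHom.ext_mint
      simp only [MonoidHom.comp_apply, MonoidHom.inl_apply]
      simp [B, hZ, L, hF, fl]
    have e2 : ((F.comp B).comp (MonoidHom.inr _ _)) = MonoidHom.inr _ _ := by
      apply PresentedGroup.ext
      rintro ⟨v, hv⟩
      simp only [MonoidHom.comp_apply, MonoidHom.inr_apply]
      simp [B, hG2, g, hF, fn v hv]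
    apply MonoidHom.ext
    rintro ⟨m, a⟩
    have h5 : F (B (m, 1)) = (m, 1) := DFunLike.congr_fun e1 m
    have h6 : F (B (1, a)) = (1, a) := DFunLike.congr_fun e2 a
    have h7 : ((m, a) : Multiplicative ℤ × ArtinGroup Γ' ℓ') = (m, 1) * (1, a) := by simp
    rw [h7, map_mul, MonoidHom.comp_apply, MonoidHom.comp_apply, h5, h6]
    rfl

set_option maxHeartbeats 4000000 in
theorem graph_part {V : Type*} [Fintype V] (Γ : SimpleGraph V) (ℓ : V → V → ℕ)
    (hsymm : ∀ u v, ℓ u v = ℓ v u) (hge : ∀ u v, Γ.Adj u v → 2 ≤ ℓ u v)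
    (hconn : Γ.Connected) (hcard : 3 ≤ Fintype.card V)
    (x y : V) (hxy : Γ.Adj x y) (hp : 2 < ℓ x y)
    (hforb : ¬ (HasForbiddenNonTriangle Γ ℓ ∨ HasForbiddenTriangle Γ ℓ)) :
    ∃ l : V, Γ.Adj x l ∧ Γ.Adj y l ∧ (∀ v, v ≠ l → Γ.Adj l v ∧ ℓ l v = 2) := by
  classical
  rw [not_or] at hforb
  obtain ⟨hnt, htri⟩ := hforb
  unfold HasForbiddenNonTriangle at hnt
  simp only [not_or] at hnt
  obtain ⟨hP4, hC4, hSp, hSpq, hP3⟩ := hnt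
  have sy : ∀ u v, Γ.Adj u v → Γ.Adj v u := fun u v h => h.symm
  have ne : ∀ u v, Γ.Adj u v → u ≠ v := fun u v h => h.ne
  have irr : ∀ u, ¬ Γ.Adj u u := fun u => Γ.irrefl
  -- induced paths of length two have both labels two
  have P3 : ∀ a b c, Γ.Adj a b → Γ.Adj b c → a ≠ c → ¬ Γ.Adj a c → ℓ a b = 2 ∧ ℓ b c = 2 := by
    intro a b c hab hbc hac hnac
    by_contra hcon
    apply hP3
    have h1 := hge _ _ hab
    have h2 := hge _ _ hbc
    refine ⟨ℓ a b, ℓ b c, h1, h2, by omega, ![a, b, c], ?_, ?_, ?_⟩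
    · intro i j
      fin_cases i <;> fin_cases j <;> simp <;> grind
    · intro i j
      fin_cases i <;> fin_cases j <;> simp [SimpleGraph.pathGraph_adj] <;> grind
    · intro i j
      fin_cases i <;> fin_cases j <;> simp [SimpleGraph.pathGraph_adj, P3Label] <;> grind
  have P4 : ∀ a b c d, Γ.Adj a b → Γ.Adj b c → Γ.Adj c d → a ≠ c → a ≠ d → b ≠ d →
      ¬ Γ.Adj a c → ¬ Γ.Adj a d → ¬ Γ.Adj b d → False := by
    intro a b c d hab hbc hcd hac had hbd nac nad nbd
    have h1 := P3 a b c hab hbc hac nac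
    have h2 := P3 b c d hbc hcd hbd nbd
    apply hP4
    refine ⟨![a, b, c, d], ?_, ?_, ?_⟩
    · intro i j
      fin_cases i <;> fin_cases j <;> simp <;> grind
    · intro i j
      fin_cases i <;> fin_cases j <;> simp [SimpleGraph.pathGraph_adj] <;> grind
    · intro i j
      fin_cases i <;> fin_cases j <;> simp [SimpleGraph.pathGraph_adj] <;> grind
  have C4 : ∀ a b c d, Γ.Adj a b → Γ.Adj b c → Γ.Adj c d → Γ.Adj d a → a ≠ c → b ≠ d →
      ¬ Γ.Adj a c → ¬ Γ.Adj b d → False := by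
    intro a b c d hab hbc hcd hda hac hbd nac nbd
    have h1 := P3 a b c hab hbc hac nac
    have h2 := P3 b c d hbc hcd hbd nbd
    have h3 := P3 c d a hcd hda hac.symm (fun h => nac h.symm)
    apply hC4
    refine ⟨![a, b, c, d], ?_, ?_, ?_⟩
    · intro i j
      fin_cases i <;> fin_cases j <;> simp <;> grind
    · intro i j
      fin_cases i <;> fin_cases j <;> simp [SimpleGraph.cycleGraph_adj'] <;> grind
    · intro i j
      fin_cases i <;> fin_cases j <;> simp [SimpleGraph.cycleGraph_adj'] <;> grind
  have T : ∀ a b c, Γ.Adj a b → Γ.Adj b c → Γ.Adj a c → 2 < ℓ a b → ℓ b c = 2 ∧ ℓ a c = 2 := by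
    intro a b c hab hbc hac h
    by_contra hcon
    apply htri
    have h1 := hge _ _ hab
    have h2 := hge _ _ hbc
    have h3 := hge _ _ hac
    refine ⟨ℓ a b, ℓ b c, ℓ a c, h1, h2, h3, by split_ifs <;> omega, ![a, b, c], ?_, ?_, ?_⟩
    · intro i j
      fin_cases i <;> fin_cases j <;> simp <;> grind
    · intro i j
      fin_cases i <;> fin_cases j <;> simp <;> grind
    · intro i j
      fin_cases i <;> fin_cases j <;> simp [triLabel] <;> grind
  have N : ∀ z, z ≠ x → z ≠ y → (Γ.Adj x z ∨ Γ.Adj y z) →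
      Γ.Adj x z ∧ Γ.Adj y z ∧ ℓ x z = 2 ∧ ℓ y z = 2 := by
    intro z hzx hzy h
    have hx : Γ.Adj x z := by
      by_contra hn
      rcases h with h | h
      · exact hn h
      · have := P3 x y z hxy h hzx.symm hn
        omega
    have hy : Γ.Adj y z := by
      by_contra hn
      have := P3 y x z hxy.symm hx hzy.symm hn
      have := hsymm x y
      omega
    have := T x y z hxy hy hx hp
    exact ⟨hx, hy, this.2, this.1⟩
  -- the link of the edge is a clique with all labels two
  have K : ∀ a c, a ≠ c → Γ.Adj x a → Γ.Adj y a → Γ.Adj x c → Γ.Adj y c →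
      Γ.Adj a c ∧ ℓ a c = 2 := by
    intro a c hac hxa hya hxc hyc
    have na := N a hxa.ne' hya.ne' (Or.inl hxa)
    have nc := N c hxc.ne' hyc.ne' (Or.inl hxc)
    have hadj : Γ.Adj a c := by
      by_contra hn
      apply hSp
      refine ⟨ℓ x y, hp, ![a, x, c, y], ?_, ?_, ?_⟩
      · intro i j
        fin_cases i <;> fin_cases j <;> simp <;> grind
      · intro i j
        fin_cases i <;> fin_cases j <;> simp [SpGraph] <;> grind
      · intro i j
        fin_cases i <;> fin_cases j <;> simp [SpGraph, SpLabel] <;> grind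
    refine ⟨hadj, ?_⟩
    by_contra hn
    have := hge _ _ hadj
    apply hSpq
    refine ⟨ℓ x y, ℓ a c, hp, by omega, ![a, x, c, y], ?_, ?_, ?_⟩
    · intro i j
      fin_cases i <;> fin_cases j <;> simp <;> grind
    · intro i j
      fin_cases i <;> fin_cases j <;> simp <;> grind
    · intro i j
      fin_cases i <;> fin_cases j <;> simp [SpqLabel] <;> grind
  -- everything is at distance at most one from the link
  have D : ∀ v, v = x ∨ v = y ∨ (∃ a, Γ.Adj x a ∧ Γ.Adj y a ∧ (v = a ∨ Γ.Adj a v)) := by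
    intro v
    have hr := hconn.preconnected x v
    rw [SimpleGraph.reachable_iff_reflTransGen] at hr
    induction hr with
    | refl => exact Or.inl rfl
    | @tail b w _ hbw ih =>
      by_cases hwx : w = x
      · exact Or.inl hwx
      by_cases hwy : w = y
      · exact Or.inr (Or.inl hwy)
      right; right
      by_cases hw : Γ.Adj x w ∨ Γ.Adj y w
      · have := N w hwx hwy hw
        exact ⟨w, this.1, this.2.1, Or.inl rfl⟩
      rw [not_or] at hw
      rcases ih with rfl | rfl | ⟨a, hxa, hya, rfl | hab⟩
      · exact absurd hbw hw.1
      · exact absurd hbw hw.2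
      · exact ⟨_, hxa, hya, Or.inr hbw⟩
      · by_cases haw : Γ.Adj a w
        · exact ⟨a, hxa, hya, Or.inr haw⟩
        by_cases hb : Γ.Adj x b ∧ Γ.Adj y b
        · exact ⟨b, hb.1, hb.2, Or.inr hbw⟩
        have hbx : b ≠ x := by rintro rfl; exact hw.1 hbw
        have hby : b ≠ y := by rintro rfl; exact hw.2 hbw
        have hxb : ¬ Γ.Adj x b := fun h => hb ⟨h, (N b hbx hby (Or.inl h)).2.1⟩
        exfalso
        exact P4 x a b w hxa hab hbw hbx.symm (Ne.symm hwx)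
          (by rintro rfl; exact hw.1 hxa) hxb hw.1 haw
  -- a common neighbour exists
  have hne : ∃ a, Γ.Adj x a ∧ Γ.Adj y a := by
    have : ∃ v, v ∉ ({x, y} : Finset V) := by
      by_contra hcon
      push Not at hcon
      have h1 : (Finset.univ : Finset V) ⊆ {x, y} := fun v _ => hcon v
      have h2 := Finset.card_le_card h1
      have h3 : ({x, y} : Finset V).card ≤ 2 := Finset.card_le_two
      rw [Finset.card_univ] at h2
      omega
    obtain ⟨v, hv⟩ := this
    simp only [Finset.mem_insert, Finset.mem_singleton, not_or] at hv
    rcases D v with h | h | ⟨a, h1, h2, _⟩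
    · exact absurd h hv.1
    · exact absurd h hv.2
    · exact ⟨a, h1, h2⟩
  let S : Finset V := Finset.univ.filter (fun a => Γ.Adj x a ∧ Γ.Adj y a)
  let nb : V → Finset V := fun a => Finset.univ.filter (fun v => v = a ∨ Γ.Adj a v)
  have hS : S.Nonempty := by
    obtain ⟨a, ha⟩ := hne
    exact ⟨a, by simp [S, ha]⟩
  obtain ⟨l, hlS, hmax⟩ := Finset.exists_max_image S (fun a => (nb a).card) hS
  have hl : Γ.Adj x l ∧ Γ.Adj y l := by simpa [S] using hlS
  have hall : ∀ v, v ≠ l → Γ.Adj l v := by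
    intro w hwl
    by_contra hlw
    have hwx : w ≠ x := by rintro rfl; exact hlw hl.1.symm
    have hwy : w ≠ y := by rintro rfl; exact hlw hl.2.symm
    rcases D w with h | h | ⟨b, hxb, hyb, hwb⟩
    · exact hwx h
    · exact hwy h
    have hbl : b ≠ l := by rintro rfl; rcases hwb with h | h; exact hwl h; exact hlw h
    have hlb := (K l b hbl.symm hl.1 hl.2 hxb hyb).1
    have hwb' : Γ.Adj b w := by
      rcases hwb with rfl | h
      · exact absurd hlb hlw
      · exact h
    have hlt : nb l ⊂ nb b := by
      rw [Finset.ssubset_iff_of_subset]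
      · exact ⟨w, by simp [nb, hwb'], by simp [nb, hwl, hlw]⟩
      · intro v hv
        simp only [nb, Finset.mem_filter, Finset.mem_univ, true_and] at hv ⊢
        rcases hv with rfl | hv
        · exact Or.inr hlb.symm
        by_contra hcon
        rw [not_or] at hcon
        have hvw : v ≠ w := by rintro rfl; exact hlw hv
        by_cases hvw' : Γ.Adj v w
        · exact C4 v l b w hv.symm hlb hwb' hvw'.symm hcon.1 hwl.symm
            (fun h => hcon.2 h.symm) hlw
        · exact P4 v l b w hv.symm hlb hwb' hcon.1 hvw hwl.symm
            (fun h => hcon.2 h.symm) hvw' hlw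
    have h1 := Finset.card_lt_card hlt
    have h2 := hmax b (by simp [S, hxb, hyb])
    omega
  refine ⟨l, hl.1, hl.2, fun v hv => ⟨hall v hv, ?_⟩⟩
  have hlN := N l hl.1.ne' hl.2.ne' (Or.inl hl.1)
  by_cases hvx : v = x
  · subst hvx; rw [hsymm]; exact hlN.2.2.1
  by_cases hvy : v = y
  · subst hvy; rw [hsymm]; exact hlN.2.2.2
  by_cases hxv : Γ.Adj x v
  · have := N v hvx hvy (Or.inl hxv)
    exact (K l v hv.symm hl.1 hl.2 this.1 this.2.1).2
  · exact (P3 x l v hl.1 (hall v hv) (Ne.symm hvx) hxv).2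

/-- Let `(Γ, ℓ)` be a connected Artin graph with at least `3` vertices,
containing an edge `{x, y}` labeled `> 2`, and with no forbidden induced labeled subgraph
(including the triangles with at most one edge labeled `2`). Then there is a common neighbor
`l` of `x` and `y` that is central in `Γ` — adjacent to every other vertex by edges labeled
`2` — and consequently `A(Γ) ≅ ℤ × A(Γ∖{l})`. -/
theorem stmt_18 {V : Type*} [Fintype V] (Γ : SimpleGraph V) (ℓ : V → V → ℕ)
    (hsymm : ∀ u v, ℓ u v = ℓ v u) (hge : ∀ u v, Γ.Adj u v → 2 ≤ ℓ u v)
    (hconn : Γ.Connected) (hcard : 3 ≤ Fintype.card V)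
    (x y : V) (hxy : Γ.Adj x y) (hp : 2 < ℓ x y)
    (hforb : ¬ (HasForbiddenNonTriangle Γ ℓ ∨ HasForbiddenTriangle Γ ℓ)) :
    ∃ l : V, Γ.Adj x l ∧ Γ.Adj y l ∧
      (∀ v, v ≠ l → Γ.Adj l v ∧ ℓ l v = 2) ∧
      Nonempty (ArtinGroup Γ ℓ ≃*
        Multiplicative ℤ ×
          ArtinGroup (Γ.induce {v : V | v ≠ l}) (fun u v => ℓ u v)) := by
  obtain ⟨l, h1, h2, h3⟩ := graph_part Γ ℓ hsymm hge hconn hcard x y hxy hp hforb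
  exact ⟨l, h1, h2, h3, central_iso Γ ℓ hsymm l h3⟩
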